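/- Let f : [0,∞) → ℝ be real analytic and algebraic (i.e., P(x, f(x)) = 0 for all x ≥ 0 for some nonzero real polynomial P), and suppose f(n) ∈ ℤ for all n in an infinite set 𝒜 of positive integers, and that f extends to all sufficiently large reals with P(x,f(x))=0. If additionally f(n) ∈ ℤ for all sufficiently large integers n, then f is a polynomial. -/

import Mathlib

open Polynomial Filter Topology
open scoped fwdDiff

/-- The real function `g` satisfies a nontrivial polynomial equation `Q(x, g x) = 0` on the
positive half-line. -/
def IsAlgebraicOnPos (g : ℝ → ℝ) : Prop :=
  ∃ Q : ℝ[X][X], Q ≠ 0 ∧ ∀ x : ℝ, 0 < x → Q.eval₂ (evalRingHom x) (g x) = 0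

/-- Evaluation of polynomials as functions on the positive half-line. -/
noncomputable def evalOnPos : ℝ[X] →+* (Set.Ioi (0 : ℝ) → ℝ) :=
  RingHom.pi fun x => evalRingHom x.1

theorem isAlgebraicOnPos_iff_isAlgebraic (g : ℝ → ℝ) :
    IsAlgebraicOnPos g ↔
      @IsAlgebraic ℝ[X] _ _ _ evalOnPos.toAlgebra (fun x : Set.Ioi (0 : ℝ) => g x) := by
  let := evalOnPos.toAlgebra
  have key : ∀ (Q : ℝ[X][X]) (x : Set.Ioi (0 : ℝ)),
      aeval (fun x : Set.Ioi (0 : ℝ) => g x) Q x = Q.eval₂ (evalRingHom x.1) (g x) := by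
    intro Q x
    have := hom_eval₂ Q evalOnPos (Pi.evalRingHom (fun _ : Set.Ioi (0 : ℝ) => ℝ) x)
      (fun x : Set.Ioi (0 : ℝ) => g x)
    exact this
  constructor
  · rintro ⟨Q, hQ, h⟩
    refine ⟨Q, hQ, ?_⟩
    funext x
    rw [key]
    exact h x x.2
  · rintro ⟨Q, hQ, h⟩
    refine ⟨Q, hQ, fun x hx => ?_⟩
    rw [← key Q ⟨x, hx⟩, h]
    rfl

namespace IsAlgebraicOnPos

theorem sub {g h : ℝ → ℝ} (hg : IsAlgebraicOnPos g) (hh : IsAlgebraicOnPos h) :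
    IsAlgebraicOnPos (g - h) := by
  rw [isAlgebraicOnPos_iff_isAlgebraic] at *
  let := evalOnPos.toAlgebra
  exact IsAlgebraic.sub hg hh

theorem eval_polynomial (q : ℝ[X]) : IsAlgebraicOnPos fun x => q.eval x :=
  ⟨X - C q, X_sub_C_ne_zero q, fun x _ => by simp⟩

theorem shift {g : ℝ → ℝ} (hg : IsAlgebraicOnPos g) : IsAlgebraicOnPos fun x => g (x + 1) := by
  obtain ⟨Q, hQ, h⟩ := hg
  refine ⟨Q.map (taylorAlgHom (1 : ℝ)).toRingHom, ?_, fun x hx => ?_⟩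
  · rwa [Ne, Polynomial.map_eq_zero_iff]
    exact taylor_injective (1 : ℝ)
  · rw [eval₂_map]
    have : (evalRingHom x).comp (taylorAlgHom (1 : ℝ)).toRingHom = evalRingHom (x + 1) := by
      ext <;> simp
    rw [this]
    exact h (x + 1) (by linarith)

theorem fwdDiff {g : ℝ → ℝ} (hg : IsAlgebraicOnPos g) : IsAlgebraicOnPos (Δ_[1] g) :=
  hg.shift.sub hg

theorem fwdDiff_iter {g : ℝ → ℝ} (hg : IsAlgebraicOnPos g) (m : ℕ) :
    IsAlgebraicOnPos ((_root_.fwdDiff 1)^[m] g) := by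
  induction m with
  | zero => exact hg
  | succ m ih =>
    rw [Function.iterate_succ_apply']
    exact ih.fwdDiff

/-- An algebraic function has at most polynomial growth. -/
theorem eventually_abs_le {g : ℝ → ℝ} (hg : IsAlgebraicOnPos g) :
    ∃ (k : ℕ) (c : ℝ), ∀ᶠ x in atTop, |g x| ≤ c * x ^ k + 1 := by
  obtain ⟨Q, hQ, h⟩ := hg
  set a := Q.leadingCoeff with ha
  have ha0 : a ≠ 0 := leadingCoeff_ne_zero.mpr hQ
  set k := (Finset.range Q.natDegree).sup fun i => (Q.coeff i).natDegree
  have hO : ∀ i ∈ Finset.range Q.natDegree, ∃ c : ℝ, 0 < c ∧ ∀ᶠ x in atTop,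
      |(Q.coeff i).eval x| ≤ c * |(a * X ^ k).eval x| := by
    intro i hi
    have := isBigO_atTop_of_degree_le (Q.coeff i) (a * X ^ k) (by
      refine degree_le_natDegree.trans ?_
      rw [degree_eq_natDegree (mul_ne_zero ha0 (pow_ne_zero _ X_ne_zero))]
      rw [natDegree_mul ha0 (pow_ne_zero _ X_ne_zero), natDegree_X_pow]
      have := Finset.le_sup (f := fun i => (Q.coeff i).natDegree) hi
      exact_mod_cast this.trans (Nat.le_add_left _ _))
    exact this.exists_pos.imp fun c hc => ⟨hc.1, hc.2.bound⟩
  choose! c hc0 hc using hO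
  refine ⟨k, ∑ i ∈ Finset.range Q.natDegree, c i, ?_⟩
  have hall : ∀ᶠ x in atTop, ∀ i ∈ Finset.range Q.natDegree,
      |(Q.coeff i).eval x| ≤ c i * |(a * X ^ k).eval x| :=
    (Filter.eventually_all_finset _).mpr hc
  filter_upwards [hall, eventually_atTop_not_isRoot a ha0, eventually_gt_atTop 0] with x hx hax hx0
  have hax' : evalRingHom x Q.leadingCoeff ≠ 0 := hax
  have hdeg := natDegree_map_of_leadingCoeff_ne_zero (evalRingHom x) hax'
  have hlead := leadingCoeff_map_of_leadingCoeff_ne_zero (evalRingHom x) hax'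
  have hne : Q.map (evalRingHom x) ≠ 0 := by
    rw [← leadingCoeff_ne_zero, hlead]
    exact hax'
  have hroot : (Q.map (evalRingHom x)).IsRoot (g x) := by
    rw [IsRoot, eval_map]
    exact h x hx0
  have hlt := hroot.norm_lt_cauchyBound hne
  rw [cauchyBound, hdeg, hlead] at hlt
  have hapos : 0 < |a.eval x| := abs_pos.mpr hax
  have hsup : ((Finset.range Q.natDegree).sup
      fun i => ‖(Q.map (evalRingHom x)).coeff i‖₊ : NNReal) ≤
        ((∑ i ∈ Finset.range Q.natDegree, c i) * x ^ k * |a.eval x| : ℝ).toNNReal := by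
    refine Finset.sup_le fun i hi => ?_
    rw [← NNReal.coe_le_coe]
    refine le_trans ?_ (Real.le_coe_toNNReal _)
    rw [coeff_map, coe_nnnorm, Real.norm_eq_abs, coe_evalRingHom]
    refine (hx i hi).trans ?_
    rw [eval_mul, eval_pow, eval_X, abs_mul, abs_of_pos (pow_pos hx0 k), mul_comm |_|, ← mul_assoc]
    gcongr
    exact Finset.single_le_sum (fun j hj => (hc0 j hj).le) hi
  have hnonneg : 0 ≤ (∑ i ∈ Finset.range Q.natDegree, c i) * x ^ k * |a.eval x| := by
    have := Finset.sum_nonneg fun i hi => (hc0 i hi).le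
    positivity
  rw [← NNReal.coe_lt_coe] at hlt
  rw [← NNReal.coe_le_coe, Real.coe_toNNReal _ hnonneg] at hsup
  rw [coe_nnnorm, Real.norm_eq_abs, NNReal.coe_add, NNReal.coe_div, coe_nnnorm, Real.norm_eq_abs,
    coe_evalRingHom, NNReal.coe_one] at hlt
  have := (div_le_iff₀ hapos).mpr hsup
  linarith

/-- A continuous algebraic function is eventually zero or eventually nonvanishing. -/
theorem eventually_eq_zero_or_ne_zero {g : ℝ → ℝ} (hg : IsAlgebraicOnPos g)
    (hcont : ContinuousOn g (Set.Ioi 0)) :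
    ∃ M : ℝ, 0 < M ∧ ((∀ x ∈ Set.Ici M, g x = 0) ∨ ∀ x ∈ Set.Ici M, g x ≠ 0) := by
  obtain ⟨Q, hQ, h⟩ := hg
  obtain ⟨R, hQR, hR⟩ := Polynomial.exists_eq_pow_rootMultiplicity_mul_and_not_dvd Q hQ 0
  rw [C_0, sub_zero] at hQR hR
  rw [X_dvd_iff] at hR
  obtain ⟨M, hM⟩ := eventually_atTop.mp
    ((eventually_atTop_not_isRoot _ hR).and (eventually_gt_atTop 0))
  have hM0 : 0 < M := (hM M le_rfl).2
  refine ⟨M, hM0, ?_⟩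
  have hsub : Set.Ici M ⊆ Set.Ioi 0 := fun x hx => lt_of_lt_of_le hM0 hx
  have hcg : ContinuousOn g (Set.Ici M) := hcont.mono hsub
  have hcR : ContinuousOn (fun x => R.eval₂ (evalRingHom x) (g x)) (Set.Ici M) := by
    simp only [eval₂_eq_sum_range, coe_evalRingHom]
    fun_prop
  by_contra! hcon
  obtain ⟨⟨x, hx, hgx⟩, y, hy, hgy⟩ := hcon
  have hfactor : ∀ x ∈ Set.Ici M, g x = 0 ∨ R.eval₂ (evalRingHom x) (g x) = 0 := by
    intro x hx
    have := h x (hsub hx)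
    rw [hQR, eval₂_mul, eval₂_pow, eval₂_X] at this
    exact (mul_eq_zero.mp this).imp_left eq_zero_of_pow_eq_zero
  obtain ⟨z, hz, ⟨_, hz1⟩, _, hz2⟩ := isPreconnected_closed_iff.mp isPreconnected_Ici
    (Set.Ici M ∩ g ⁻¹' {0}) (Set.Ici M ∩ (fun x => R.eval₂ (evalRingHom x) (g x)) ⁻¹' {0})
    (hcg.preimage_isClosed_of_isClosed isClosed_Ici isClosed_singleton)
    (hcR.preimage_isClosed_of_isClosed isClosed_Ici isClosed_singleton)
    (fun x hx => (hfactor x hx).imp (fun h => ⟨hx, h⟩) (fun h => ⟨hx, h⟩))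
    ⟨y, hy, hy, hgy⟩ ⟨x, hx, hx, (hfactor x hx).resolve_left hgx⟩
  simp only [Set.mem_preimage, Set.mem_singleton_iff] at hz1 hz2
  rw [hz1, eval₂_at_zero] at hz2
  exact (hM z hz).1 hz2

/-- A continuous algebraic function eventually has constant sign. -/
theorem eventually_sign {g : ℝ → ℝ} (hg : IsAlgebraicOnPos g)
    (hcont : ContinuousOn g (Set.Ioi 0)) :
    ∃ M : ℝ, 0 < M ∧ ((∀ x ∈ Set.Ici M, g x = 0) ∨ (∀ x ∈ Set.Ici M, 0 < g x) ∨
      ∀ x ∈ Set.Ici M, g x < 0) := by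
  obtain ⟨M, hM0, hM | hM⟩ := hg.eventually_eq_zero_or_ne_zero hcont
  · exact ⟨M, hM0, .inl hM⟩
  refine ⟨M, hM0, .inr ?_⟩
  by_contra! hcon
  obtain ⟨⟨x, hx, hgx⟩, y, hy, hgy⟩ := hcon
  have hcg : ContinuousOn g (Set.Ici M) :=
    hcont.mono fun x hx => lt_of_lt_of_le hM0 hx
  obtain ⟨z, hz, hz0⟩ := isPreconnected_Ici.intermediate_value hx hy hcg ⟨hgx, hgy⟩
  exact hM z hz hz0

end IsAlgebraicOnPos

theorem tendsto_atTop_of_one_le_fwdDiff {v : ℝ → ℝ} (h : ∀ᶠ n : ℕ in atTop, 1 ≤ Δ_[1] v n) :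
    Tendsto (fun n : ℕ => v n) atTop atTop := by
  obtain ⟨N, hN⟩ := eventually_atTop.mp h
  have key : ∀ n : ℕ, v N + n ≤ v ((n + N : ℕ) : ℝ) := by
    intro n
    induction n with
    | zero => simp
    | succ n ih =>
      have := hN (n + N) (by omega)
      rw [fwdDiff] at this
      push_cast at *
      rw [show (n : ℝ) + 1 + N = n + N + 1 by ring]
      linarith
  rw [← tendsto_add_atTop_iff_nat N]
  exact tendsto_atTop_mono key (tendsto_atTop_add_const_left _ _ tendsto_natCast_atTop_atTop)

theorem tendsto_atTop_of_one_le_fwdDiff_iter (m : ℕ) {v : ℝ → ℝ}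
    (h : ∀ᶠ n : ℕ in atTop, 1 ≤ (fwdDiff 1)^[m + 1] v n) :
    Tendsto (fun n : ℕ => v n) atTop atTop := by
  induction m generalizing v with
  | zero => exact tendsto_atTop_of_one_le_fwdDiff h
  | succ m ih =>
    rw [Function.iterate_succ_apply] at h
    exact tendsto_atTop_of_one_le_fwdDiff ((ih h).eventually_ge_atTop 1)

/-- If the `(k + 1)`-st differences are at least one, the growth exceeds every `c * n ^ k + 1`. -/
theorem not_eventually_one_le_fwdDiff_iter {u : ℝ → ℝ} {k : ℕ} {c : ℝ}
    (hu : ∀ᶠ x in atTop, u x ≤ c * x ^ k + 1) :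
    ¬ ∀ᶠ n : ℕ in atTop, 1 ≤ (fwdDiff 1)^[k + 1] u n := by
  intro h
  have hv : (fwdDiff 1)^[k + 1] (u + (-c) • fun x : ℝ => x ^ k) = (fwdDiff 1)^[k + 1] u := by
    rw [fwdDiff_iter_add, fwdDiff_iter_const_smul,
      fwdDiff_iter_pow_eq_zero_of_lt (Nat.lt_succ_self k), smul_zero, add_zero]
  rw [← hv] at h
  have h1 := (tendsto_atTop_of_one_le_fwdDiff_iter k h).eventually_gt_atTop 1
  obtain ⟨n, hn1, hn2⟩ := (h1.and (tendsto_natCast_atTop_atTop.eventually hu)).exists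
  simp only [Pi.add_apply, Pi.smul_apply, smul_eq_mul] at hn1
  linarith

theorem continuousOn_fwdDiff_iter {g : ℝ → ℝ} (hg : ContinuousOn g (Set.Ioi 0)) (m : ℕ) :
    ContinuousOn ((fwdDiff 1)^[m] g) (Set.Ioi 0) := by
  induction m with
  | zero => exact hg
  | succ m ih =>
    rw [Function.iterate_succ_apply']
    refine (ih.comp (by fun_prop) fun x hx => ?_).sub ih
    exact lt_trans (Set.mem_Ioi.mp hx) (lt_add_one x)

theorem fwdDiff_iter_integer_valued {g : ℝ → ℝ} {N : ℕ}
    (hg : ∀ n : ℕ, N ≤ n → ∃ j : ℤ, g n = j) (m : ℕ) :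
    ∀ n : ℕ, N ≤ n → ∃ j : ℤ, (fwdDiff 1)^[m] g n = j := by
  induction m with
  | zero => exact hg
  | succ m ih =>
    intro n hn
    obtain ⟨i, hi⟩ := ih n hn
    obtain ⟨j, hj⟩ := ih (n + 1) (by omega)
    refine ⟨j - i, ?_⟩
    rw [Function.iterate_succ_apply', fwdDiff, hi, ← Nat.cast_succ, hj]
    push_cast
    ring

theorem fwdDiff_iter_neg (m : ℕ) (g : ℝ → ℝ) : (fwdDiff 1)^[m] (-g) = -(fwdDiff 1)^[m] g := by
  simpa using fwdDiff_iter_const_smul (1 : ℝ) (-1 : ℝ) g m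

theorem eventually_fwdDiff_iter_eq_zero {g : ℝ → ℝ} (hg : IsAlgebraicOnPos g)
    (hcont : ContinuousOn g (Set.Ioi 0))
    (hint : ∃ N : ℕ, ∀ n : ℕ, N ≤ n → ∃ j : ℤ, g n = j) :
    ∃ (m : ℕ) (M : ℝ), ∀ x, M ≤ x → (fwdDiff 1)^[m] g x = 0 := by
  obtain ⟨N, hN⟩ := hint
  obtain ⟨k, c, hk⟩ := hg.eventually_abs_le
  have hN' := fwdDiff_iter_integer_valued hN (k + 1)
  obtain ⟨M, -, hM | hM | hM⟩ :=
    (hg.fwdDiff_iter (k + 1)).eventually_sign (continuousOn_fwdDiff_iter hcont (k + 1))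
  · exact ⟨k + 1, M, hM⟩
  · refine (not_eventually_one_le_fwdDiff_iter
      (hk.mono fun x hx => (le_abs_self _).trans hx) ?_).elim
    filter_upwards [eventually_ge_atTop N,
      tendsto_natCast_atTop_atTop.eventually (eventually_ge_atTop M)] with n hn hnM
    obtain ⟨j, hj⟩ := hN' n hn
    have := hM n hnM
    rw [hj] at this ⊢
    exact_mod_cast this
  · refine (not_eventually_one_le_fwdDiff_iter (u := -g)
      (hk.mono fun x hx => (neg_le_abs _).trans hx) ?_).elim
    filter_upwards [eventually_ge_atTop N,
      tendsto_natCast_atTop_atTop.eventually (eventually_ge_atTop M)] with n hn hnM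
    obtain ⟨j, hj⟩ := hN' n hn
    have := hM n hnM
    rw [fwdDiff_iter_neg, Pi.neg_apply]
    rw [hj] at this ⊢
    have h0 : j < 0 := by exact_mod_cast this
    have h1 : 1 ≤ -j := by omega
    exact_mod_cast h1

/-- Newton interpolation: a function whose `m`-th differences eventually vanish agrees with a
polynomial at large integers. -/
theorem exists_polynomial_eq_of_fwdDiff_iter_eq_zero {g : ℝ → ℝ} {m : ℕ} {M : ℝ}
    (h : ∀ x, M ≤ x → (fwdDiff 1)^[m] g x = 0) :
    ∃ (q : ℝ[X]) (N : ℕ), ∀ n : ℕ, N ≤ n → g n = q.eval (n : ℝ) := by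
  obtain ⟨N, hN⟩ := exists_nat_ge M
  have hzero : ∀ j : ℕ, ∀ x, M ≤ x → (fwdDiff 1)^[m + j] g x = 0 := by
    intro j
    induction j with
    | zero => exact h
    | succ j ih =>
      intro x hx
      rw [← add_assoc, Function.iterate_succ_apply', fwdDiff, ih x hx, ih (x + 1) (by linarith),
        sub_zero]
  refine ⟨∑ k ∈ Finset.range m, C ((fwdDiff 1)^[k] g N / k.factorial) *
    (descPochhammer ℝ k).comp (X - C (N : ℝ)), N, fun n hn => ?_⟩
  obtain ⟨n, rfl⟩ := Nat.exists_eq_add_of_le hn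
  have hnewton := shift_eq_sum_fwdDiff_iter (1 : ℝ) g n N
  rw [nsmul_one] at hnewton
  push_cast
  rw [hnewton, eval_finsetSum]
  have hterm : ∀ k, (C ((fwdDiff 1)^[k] g N / k.factorial) *
      (descPochhammer ℝ k).comp (X - C (N : ℝ))).eval ((N : ℝ) + n) =
        n.choose k • (fwdDiff 1)^[k] g N := by
    intro k
    rw [eval_mul, eval_C, eval_comp, eval_sub, eval_X, eval_C, add_sub_cancel_left,
      descPochhammer_eval_eq_descFactorial, Nat.descFactorial_eq_factorial_mul_choose, nsmul_eq_mul]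
    have : (k.factorial : ℝ) ≠ 0 := by positivity
    push_cast
    field_simp
  rw [Finset.sum_congr rfl fun k _ => hterm k]
  have hl : ∑ k ∈ Finset.range (n + 1), n.choose k • (fwdDiff 1)^[k] g N =
      ∑ k ∈ Finset.range (n + 1 + m), n.choose k • (fwdDiff 1)^[k] g N := by
    refine Finset.sum_subset (Finset.range_mono (by omega)) fun k _ hk => ?_
    rw [Nat.choose_eq_zero_of_lt (by rw [Finset.mem_range] at hk; omega), zero_smul]
  have hr : ∑ k ∈ Finset.range m, n.choose k • (fwdDiff 1)^[k] g N =
      ∑ k ∈ Finset.range (n + 1 + m), n.choose k • (fwdDiff 1)^[k] g N := by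
    refine Finset.sum_subset (Finset.range_mono (by omega)) fun k _ hk => ?_
    obtain ⟨j, rfl⟩ := Nat.exists_eq_add_of_le (by simpa using hk : m ≤ k)
    rw [hzero j N hN, smul_zero]
  rw [hl, hr]

/-- A continuous algebraic function taking integer values at all large integers is eventually
a polynomial. -/
theorem IsAlgebraicOnPos.exists_polynomial_eq {g : ℝ → ℝ} (hg : IsAlgebraicOnPos g)
    (hcont : ContinuousOn g (Set.Ioi 0))
    (hint : ∃ N : ℕ, ∀ n : ℕ, N ≤ n → ∃ j : ℤ, g n = j) :
    ∃ (q : ℝ[X]) (M : ℝ), 0 < M ∧ ∀ x, M ≤ x → g x = q.eval x := by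
  obtain ⟨m, L, hL⟩ := eventually_fwdDiff_iter_eq_zero hg hcont hint
  obtain ⟨q, N, hq⟩ := exists_polynomial_eq_of_fwdDiff_iter_eq_zero hL
  obtain ⟨M, hM0, hM | hM⟩ := (hg.sub (eval_polynomial q)).eventually_eq_zero_or_ne_zero
    (hcont.sub q.continuous.continuousOn)
  · exact ⟨q, M, hM0, fun x hx => sub_eq_zero.mp (hM x hx)⟩
  · obtain ⟨n, hn⟩ := exists_nat_ge (max M N)
    refine (hM n ((le_max_left _ _).trans hn) (sub_eq_zero.mpr (hq n ?_))).elim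
    exact_mod_cast (le_max_right _ _).trans hn

/-- A function annihilated by a nonzero `MvPolynomial` in two variables is algebraic. -/
theorem IsAlgebraicOnPos.of_mvPolynomial {f : ℝ → ℝ} {P : MvPolynomial (Fin 2) ℝ} (hP : P ≠ 0)
    (h : ∀ x : ℝ, 0 ≤ x → MvPolynomial.eval (fun i : Fin 2 => if i = 0 then x else f x) P = 0) :
    IsAlgebraicOnPos f := by
  let φ : MvPolynomial (Fin 2) ℝ →+* ℝ[X][X] :=
    MvPolynomial.eval₂Hom (C.comp C) fun i => if i = 0 then C X else X
  let ψ : ℝ[X][X] →+* MvPolynomial (Fin 2) ℝ :=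
    eval₂RingHom (eval₂RingHom MvPolynomial.C (MvPolynomial.X 0)) (MvPolynomial.X 1)
  have hψφ : ψ.comp φ = RingHom.id _ := by
    refine MvPolynomial.ringHom_ext (fun r => by simp [φ, ψ]) fun i => ?_
    fin_cases i <;> simp [φ, ψ]
  have hinj : Function.LeftInverse ψ φ := fun p => RingHom.congr_fun hψφ p
  refine ⟨φ P, fun h0 => hP (hinj.injective (h0.trans (map_zero φ).symm)), fun x hx => ?_⟩
  have hcomp : (eval₂RingHom (evalRingHom x) (f x)).comp φ =
      MvPolynomial.eval (fun i : Fin 2 => if i = 0 then x else f x) := by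
    refine MvPolynomial.ringHom_ext (fun r => by simp [φ]) fun i => ?_
    fin_cases i <;> simp [φ]
  exact (RingHom.congr_fun hcomp P).trans (h x hx.le)


/-- (Serre) A real analytic algebraic function f on [0,∞) (so P(x,f(x)) = 0 for
    a nonzero real polynomial P) which takes integer values on an infinite set
    𝒜 of positive integers and at all sufficiently large integers is a
    polynomial. -/
theorem algebraic_integer_valued (f : ℝ → ℝ)
    (hf : AnalyticOn ℝ f (Set.Ici 0))
    (P : MvPolynomial (Fin 2) ℝ) (hP : P ≠ 0)
    (halg : ∀ x : ℝ, 0 ≤ x →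
      MvPolynomial.eval (fun i : Fin 2 => if i = 0 then x else f x) P = 0)
    (A : Set ℕ) (hA : A.Infinite) (hApos : ∀ n ∈ A, 0 < n)
    (hint : ∀ n ∈ A, ∃ m : ℤ, f n = m)
    (hint' : ∃ N : ℕ, ∀ n : ℕ, N ≤ n → ∃ m : ℤ, f n = m) :
    ∃ q : Polynomial ℝ, ∀ x : ℝ, 0 ≤ x → f x = q.eval x := by
  obtain ⟨q, M, hM0, hq⟩ := (IsAlgebraicOnPos.of_mvPolynomial hP halg).exists_polynomial_eq
    (hf.continuousOn.mono Set.Ioi_subset_Ici_self) hint'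
  refine ⟨q, fun x hx => ?_⟩
  have hfa : AnalyticOnNhd ℝ f (Set.Ioi 0) :=
    isOpen_Ioi.analyticOn_iff_analyticOnNhd.mp (hf.mono Set.Ioi_subset_Ici_self)
  have heq : Set.EqOn f (fun x => q.eval x) (Set.Ioi 0) := by
    refine hfa.eqOn_of_preconnected_of_eventuallyEq (fun x _ => ?_) isPreconnected_Ioi
      (z₀ := M + 1) (Set.mem_Ioi.mpr (by linarith)) ?_
    · simpa using (AnalyticAt.aeval_polynomial (analyticAt_id (𝕜 := ℝ) (z := x)) q)
    · filter_upwards [Ioi_mem_nhds (lt_add_one M)] with y hy using hq y (Set.mem_Ioi.mp hy).le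
  exact heq.of_subset_closure hf.continuousOn q.continuous.continuousOn Set.Ioi_subset_Ici_self
    (closure_Ioi (0 : ℝ)).ge hx
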